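/- If A ∈ ℝ^{n×n} is a premetric and x ∈ ℝⁿ, then A ⊙ x = x if and only if x_i − x_j ≤ A_{ij} for all i, j ∈ [n]; consequently im(A*) = {x ∈ ℝⁿ : x_i − x_j ≤ A_{ij} for all i, j}. -/

import Mathlib

namespace TropComm

variable {n : ℕ}

/-- Tropical (min-plus) matrix product: `(A ⊙ B) i j = min_s (A i s + B s j)`. -/
def tropMul [NeZero n] (A B : Fin n → Fin n → ℝ) : Fin n → Fin n → ℝ :=
  fun i j => Finset.univ.inf' Finset.univ_nonempty (fun s => A i s + B s j)

/-- Tropical matrix-vector product: `(A ⊙ x) i = min_j (A i j + x j)`. -/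
def tropMulVec [NeZero n] (A : Fin n → Fin n → ℝ) (x : Fin n → ℝ) : Fin n → ℝ :=
  fun i => Finset.univ.inf' Finset.univ_nonempty (fun j => A i j + x j)

/-- Tropical sum: entrywise minimum. -/
def tropSum (A B : Fin n → Fin n → ℝ) : Fin n → Fin n → ℝ :=
  fun i j => min (A i j) (B i j)

/-- `tropPow A k` is the k-fold tropical product `A^{⊙k}` (with the junk value
`tropPow A 0 = A`; only exponents `k ≥ 1` are ever used). -/
def tropPow [NeZero n] (A : Fin n → Fin n → ℝ) : ℕ → (Fin n → Fin n → ℝ)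
  | 0 => A
  | 1 => A
  | (k + 2) => tropMul A (tropPow A (k + 1))

/-- Kleene star `A* = A ⊕ A^{⊙2} ⊕ ⋯ ⊕ A^{⊙n}`. -/
def kleene [NeZero n] (A : Fin n → Fin n → ℝ) : Fin n → Fin n → ℝ :=
  fun i j => Finset.univ.inf' Finset.univ_nonempty (fun k : Fin n => tropPow A (k.val + 1) i j)

/-- A premetric: zero diagonal, positive off-diagonal entries. -/
def IsPremetric (A : Fin n → Fin n → ℝ) : Prop :=
  (∀ i, A i i = 0) ∧ ∀ i j, i ≠ j → 0 < A i j

/-- A polytrope: a premetric satisfying the triangle inequality. -/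
def IsPolytrope (A : Fin n → Fin n → ℝ) : Prop :=
  IsPremetric A ∧ ∀ i j k, A i j ≤ A i k + A k j


/-- The image of a matrix: `im(A) = {A ⊙ x : x ∈ ℝⁿ}`. -/
def tropIm [NeZero n] (A : Fin n → Fin n → ℝ) : Set (Fin n → ℝ) :=
  Set.range (tropMulVec A)

/-- `SimplePath A j S i c` says that there is a path from `i` to `j` without repeated vertices,
with vertex set `S` and total weight `c`. -/
inductive SimplePath (A : Fin n → Fin n → ℝ) (j : Fin n) : Finset (Fin n) → Fin n → ℝ → Prop
  | nil : SimplePath A j {j} j 0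
  | cons {S : Finset (Fin n)} {s : Fin n} {c : ℝ} (i : Fin n) (h : SimplePath A j S s c)
      (hi : i ∉ S) : SimplePath A j (insert i S) i (A i s + c)

theorem IsPremetric.nonneg {A : Fin n → Fin n → ℝ} (hA : IsPremetric A) (i j : Fin n) :
    0 ≤ A i j := by
  rcases eq_or_ne i j with rfl | h
  · exact (hA.1 i).ge
  · exact (hA.2 i j h).le

theorem SimplePath.exists_suffix {A : Fin n → Fin n → ℝ} (hA : IsPremetric A)
    {j s : Fin n} {S : Finset (Fin n)} {c : ℝ} (h : SimplePath A j S s c) :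
    ∀ i ∈ S, ∃ T d, d ≤ c ∧ SimplePath A j T i d := by
  induction h with
  | nil =>
    intro i hi
    obtain rfl := Finset.mem_singleton.mp hi
    exact ⟨_, _, le_rfl, .nil⟩
  | @cons S s c k h hk ih =>
    intro i hi
    rcases Finset.mem_insert.mp hi with rfl | hi
    · exact ⟨_, _, le_rfl, .cons i h hk⟩
    · obtain ⟨T, d, hd, hT⟩ := ih i hi
      exact ⟨T, d, by linarith [hA.nonneg k s], hT⟩

theorem SimplePath.exists_le_add {A : Fin n → Fin n → ℝ} (hA : IsPremetric A)
    {j s : Fin n} {S : Finset (Fin n)} {c : ℝ} (h : SimplePath A j S s c) (i : Fin n) :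
    ∃ T d, d ≤ A i s + c ∧ SimplePath A j T i d := by
  by_cases hi : i ∈ S
  · obtain ⟨T, d, hd, hT⟩ := h.exists_suffix hA i hi
    exact ⟨T, d, by linarith [hA.nonneg i s], hT⟩
  · exact ⟨_, _, le_rfl, .cons i h hi⟩

section

variable [NeZero n]

theorem exists_simplePath_le_tropPow {A : Fin n → Fin n → ℝ} (hA : IsPremetric A) (k : ℕ)
    (i j : Fin n) : ∃ S c, c ≤ tropPow A (k + 1) i j ∧ SimplePath A j S i c := by
  induction k generalizing i with
  | zero =>
    obtain ⟨T, d, hd, hT⟩ := (SimplePath.nil (A := A) (j := j)).exists_le_add hA i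
    exact ⟨T, d, by simpa [tropPow] using hd, hT⟩
  | succ k ih =>
    obtain ⟨s, -, hs⟩ := Finset.exists_mem_eq_inf' Finset.univ_nonempty
      (fun s => A i s + tropPow A (k + 1) s j)
    obtain ⟨S, c, hc, hS⟩ := ih s
    obtain ⟨T, d, hd, hT⟩ := hS.exists_le_add hA i
    refine ⟨T, d, ?_, hT⟩
    change d ≤ Finset.univ.inf' Finset.univ_nonempty (fun s => A i s + tropPow A (k + 1) s j)
    rw [hs]
    linarith

theorem SimplePath.tropPow_card_le {A : Fin n → Fin n → ℝ} (hA : IsPremetric A)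
    {i j : Fin n} {S : Finset (Fin n)} {c : ℝ} (h : SimplePath A j S i c) :
    0 < S.card ∧ tropPow A S.card i j ≤ c := by
  induction h with
  | nil => simp [tropPow, hA.1 j]
  | @cons S s c i h hi ih =>
    obtain ⟨hpos, hle⟩ := ih
    rw [Finset.card_insert_of_notMem hi]
    refine ⟨Nat.succ_pos _, ?_⟩
    obtain ⟨m, hm⟩ := Nat.exists_eq_succ_of_ne_zero hpos.ne'
    rw [hm] at hle ⊢
    exact (Finset.inf'_le (fun s => A i s + tropPow A (m + 1) s j)
      (Finset.mem_univ s)).trans (by gcongr)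

theorem SimplePath.kleene_le {A : Fin n → Fin n → ℝ} (hA : IsPremetric A)
    {i j : Fin n} {S : Finset (Fin n)} {c : ℝ} (h : SimplePath A j S i c) :
    kleene A i j ≤ c := by
  obtain ⟨hpos, hle⟩ := h.tropPow_card_le hA
  have hcard : S.card ≤ n := by simpa using S.card_le_univ
  obtain ⟨m, hm⟩ := Nat.exists_eq_succ_of_ne_zero hpos.ne'
  rw [hm] at hle hcard
  exact (Finset.inf'_le (fun k : Fin n => tropPow A (k.val + 1) i j)
    (Finset.mem_univ ⟨m, hcard⟩)).trans hle

theorem kleene_self_le {A : Fin n → Fin n → ℝ} (hA : IsPremetric A) (i : Fin n) :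
    kleene A i i ≤ 0 :=
  SimplePath.nil.kleene_le hA

theorem kleene_le_add {A : Fin n → Fin n → ℝ} (hA : IsPremetric A) (i s j : Fin n) :
    kleene A i j ≤ A i s + kleene A s j := by
  obtain ⟨k, -, hk⟩ := Finset.exists_mem_eq_inf' Finset.univ_nonempty
    (fun k : Fin n => tropPow A (k.val + 1) s j)
  obtain ⟨S, c, hc, hS⟩ := exists_simplePath_le_tropPow hA k s j
  obtain ⟨T, d, hd, hT⟩ := hS.exists_le_add hA i
  have hkl : kleene A s j = tropPow A (k.val + 1) s j := hk
  linarith [hT.kleene_le hA]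

theorem sub_le_tropPow {A : Fin n → Fin n → ℝ} {x : Fin n → ℝ}
    (hx : ∀ i j, x i - x j ≤ A i j) (k : ℕ) (i j : Fin n) :
    x i - x j ≤ tropPow A (k + 1) i j := by
  induction k generalizing i with
  | zero => exact hx i j
  | succ k ih => exact Finset.le_inf' Finset.univ_nonempty _ fun s _ => by linarith [hx i s, ih s]

theorem sub_le_kleene {A : Fin n → Fin n → ℝ} {x : Fin n → ℝ}
    (hx : ∀ i j, x i - x j ≤ A i j) (i j : Fin n) : x i - x j ≤ kleene A i j :=
  Finset.le_inf' _ _ fun k _ => sub_le_tropPow hx k i j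

theorem tropMulVec_le (A : Fin n → Fin n → ℝ) (x : Fin n → ℝ) (i j : Fin n) :
    tropMulVec A x i ≤ A i j + x j :=
  Finset.inf'_le (fun j => A i j + x j) (Finset.mem_univ j)

theorem tropMulVec_eq_self {A : Fin n → Fin n → ℝ} (hA : ∀ i, A i i ≤ 0) {x : Fin n → ℝ}
    (hx : ∀ i j, x i - x j ≤ A i j) : tropMulVec A x = x := by
  funext i
  refine le_antisymm ?_ (Finset.le_inf' _ _ fun j _ => by linarith [hx i j])
  linarith [tropMulVec_le A x i i, hA i]

end

/-- If `A` is a premetric and `x ∈ ℝⁿ`, then `A ⊙ x = x` iff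
`xᵢ − xⱼ ≤ Aᵢⱼ` for all `i, j`; consequently
`im(A*) = {x : xᵢ − xⱼ ≤ Aᵢⱼ for all i, j}`. -/
theorem stmt11 {n : ℕ} [NeZero n] (A : Fin n → Fin n → ℝ)
    (hA : IsPremetric A) :
    (∀ x : Fin n → ℝ, tropMulVec A x = x ↔ ∀ i j, x i - x j ≤ A i j) ∧
    tropIm (kleene A) = {x : Fin n → ℝ | ∀ i j, x i - x j ≤ A i j} := by
  refine ⟨fun x => ⟨fun h i j => ?_, tropMulVec_eq_self fun i => (hA.1 i).le⟩,
    Set.Subset.antisymm ?_ fun x hx =>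
      ⟨x, tropMulVec_eq_self (kleene_self_le hA) (sub_le_kleene hx)⟩⟩
  · have hij := tropMulVec_le A x i j
    rw [h] at hij
    linarith
  · rintro _ ⟨z, rfl⟩ i j
    obtain ⟨s, -, hs⟩ := Finset.exists_mem_eq_inf' Finset.univ_nonempty
      (fun s => kleene A j s + z s)
    have hj : tropMulVec (kleene A) z j = kleene A j s + z s := hs
    linarith [tropMulVec_le (kleene A) z i s, kleene_le_add hA i j s]

end TropComm
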